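/- The dual cone K_d^+ has at most Σ_{p=1}^{d−1} C(d−2, p−1)·C(d, p) extreme directions (counted up to positive scaling), where C(n,k) denotes the binomial coefficient. -/

import Mathlib

noncomputable section

/-- The solvency cone induced by the matrix `π`: the set of all nonnegative linear
combinations of the vectors `π i j • e^i - e^j`. -/
def solvencyCone (d : ℕ) (π : Fin d → Fin d → ℝ) : Set (Fin d → ℝ) :=
  {x | ∃ z : Fin d → Fin d → ℝ, (∀ i j, 0 ≤ z i j) ∧
    x = ∑ i : Fin d, ∑ j : Fin d, z i j • (π i j • (Pi.single i 1 : Fin d → ℝ) - (Pi.single j 1 : Fin d → ℝ))}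

/-- The (positive) dual cone of a set `K ⊆ ℝ^d`. -/
def dualCone (d : ℕ) (K : Set (Fin d → ℝ)) : Set (Fin d → ℝ) :=
  {y | ∀ x ∈ K, 0 ≤ ∑ l : Fin d, x l * y l}

/-- `(P, N)` is a bipartition of the vertex set `{1,…,d}`: both parts are nonempty,
disjoint, and their union is everything. -/
def IsBipartition (d : ℕ) (P N : Finset (Fin d)) : Prop :=
  P.Nonempty ∧ N.Nonempty ∧ Disjoint P N ∧ P ∪ N = Finset.univ

/-- `T` is a spanning tree of the bipartite digraph with arc set `E`:
its arcs lie in `E` and the underlying undirected graph on all of `Fin d`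
is connected and acyclic. -/
def IsSpanningTreeOf (d : ℕ) (E T : Set (Fin d × Fin d)) : Prop :=
  T ⊆ E ∧ (SimpleGraph.fromRel (fun u v => (u, v) ∈ T)).IsTree

/-- `T` is a spanning tree of the bipartite digraph `G(P,N)` with arc set `P × N`. -/
def IsSpanningTree (d : ℕ) (P N : Finset (Fin d)) (T : Set (Fin d × Fin d)) : Prop :=
  IsSpanningTreeOf d {a | a.1 ∈ P ∧ a.2 ∈ N} T

/-- The vector `y` is generated by the tree with arc set `T`:
`π i j * y i = y j > 0` along all arcs of `T`. -/
def GeneratedByTree (d : ℕ) (π : Fin d → Fin d → ℝ) (T : Set (Fin d × Fin d))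
    (y : Fin d → ℝ) : Prop :=
  ∀ a ∈ T, π a.1 a.2 * y a.1 = y a.2 ∧ 0 < y a.2

/-- The vector `y` is feasible with respect to the bipartition `(P, N)`:
`π i j * y i ≥ y j > 0` for all `(i,j) ∈ P × N`. -/
def Feasible (d : ℕ) (π : Fin d → Fin d → ℝ) (P N : Finset (Fin d))
    (y : Fin d → ℝ) : Prop :=
  ∀ i ∈ P, ∀ j ∈ N, y j ≤ π i j * y i ∧ 0 < y j

/-- `y` is a feasible tree solution with respect to `(P, N)`. -/
def IsFeasibleTreeSolution (d : ℕ) (π : Fin d → Fin d → ℝ) (P N : Finset (Fin d))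
    (y : Fin d → ℝ) : Prop :=
  ∃ T : Set (Fin d × Fin d), IsSpanningTree d P N T ∧ GeneratedByTree d π T y ∧
    Feasible d π P N y

/-- `y` is an extreme direction of the cone `K`: it is a nonzero element of `K`
which cannot be written as the sum of two directions of `K` that are not positive
multiples of `y`. -/
def IsExtremeDir (d : ℕ) (K : Set (Fin d → ℝ)) (y : Fin d → ℝ) : Prop :=
  y ∈ K ∧ y ≠ 0 ∧ ∀ u v : Fin d → ℝ, u ∈ K → v ∈ K → u ≠ 0 → v ≠ 0 → y = u + v →
    (∃ α : ℝ, 0 < α ∧ u = α • y) ∨ (∃ α : ℝ, 0 < α ∧ v = α • y)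

/-- The degree of node `i` in the arc set `T`: the number of arcs incident to `i`. -/
def treeDeg (d : ℕ) (T : Set (Fin d × Fin d)) (i : Fin d) : ℕ :=
  {a ∈ T | a.1 = i ∨ a.2 = i}.ncard

theorem sum_degree_lt_card_of_closed {V : Type*} [Fintype V] {G : SimpleGraph V}
    [DecidableRel G.Adj] [DecidableEq V] (hG : G.IsAcyclic) {P S : Finset V}
    (hP : ∀ u v, G.Adj u v → (u ∈ P ↔ v ∉ P)) (hS : S.Nonempty)
    (hcl : ∀ u v, G.Adj u v → u ∈ P → u ∈ S → v ∈ S) :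
    ∑ i ∈ P with i ∈ S, G.degree i < S.card := by
  classical
  have : Nonempty S := hS.to_subtype
  set F : SimpleGraph S := G.induce (S : Set V) with hF
  obtain ⟨T, hFT, hT⟩ :=
    (SimpleGraph.connected_top (V := S)).exists_isTree_le_of_le_of_isAcyclic
      (le_top : F ≤ ⊤) (hG.induce S)
  have hT := hT.2.card_edgeFinset
  have hle : F.edgeFinset.card ≤ T.edgeFinset.card :=
    Finset.card_le_card (SimpleGraph.edgeFinset_mono hFT)
  have hbip : F.IsBipartiteWith (P.subtype (· ∈ S) : Finset S) ((Pᶜ).subtype (· ∈ S) : Finset S) := by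
    constructor
    · rw [Set.disjoint_left]
      intro x; simp
    · intro v w hvw
      have := hP v w hvw
      simp only [Finset.mem_coe, Finset.mem_subtype, Finset.mem_compl]
      tauto
  have hsum := SimpleGraph.isBipartiteWith_sum_degrees_eq_card_edges hbip
  have hdeg : ∑ i ∈ P with i ∈ S, G.degree i = ∑ v ∈ P.subtype (· ∈ S), F.degree v := by
    rw [← Finset.sum_subtype_eq_sum_filter]
    refine Finset.sum_congr rfl fun v hv => ?_
    rw [Finset.mem_subtype] at hv
    have h : G.neighborSet v ⊆ (S : Set V) := fun w hw => hcl v w hw hv v.2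
    convert (SimpleGraph.degree_induce_of_neighborSet_subset h).symm
    exact Finset.mem_coe.symm
  rw [hdeg, hsum]
  simp only [Fintype.card_coe] at hT
  omega

theorem SimpleGraph.IsTree.sum_degree_bipartite {V : Type*} [Fintype V] {G : SimpleGraph V}
    [DecidableRel G.Adj] [DecidableEq V] (hG : G.IsTree) {P : Finset V}
    (hP : ∀ u v, G.Adj u v → (u ∈ P ↔ v ∉ P)) :
    ∑ i ∈ P, G.degree i + 1 = Fintype.card V := by
  have hbip : G.IsBipartiteWith (P : Set V) ((Pᶜ : Finset V) : Set V) := by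
    constructor
    · rw [Set.disjoint_left]
      intro x; simp
    · intro v w hvw
      have := hP v w hvw
      simp only [Finset.mem_coe, Finset.mem_compl]
      tauto
  rw [SimpleGraph.isBipartiteWith_sum_degrees_eq_card_edges hbip, hG.card_edgeFinset]

theorem eq_univ_of_closed_of_degree_eq {V : Type*} [Fintype V] [DecidableEq V]
    {G H : SimpleGraph V} [DecidableRel G.Adj] [DecidableRel H.Adj]
    (hG : G.IsTree) (hH : H.IsTree) {P S : Finset V}
    (hGP : ∀ u v, G.Adj u v → (u ∈ P ↔ v ∉ P)) (hHP : ∀ u v, H.Adj u v → (u ∈ P ↔ v ∉ P))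
    (hdeg : ∀ i ∈ P, G.degree i = H.degree i) (hS : S.Nonempty)
    (hGS : ∀ u v, G.Adj u v → u ∈ P → u ∈ S → v ∈ S)
    (hHS : ∀ u v, H.Adj u v → u ∈ P → v ∈ S → u ∈ S) : S = Finset.univ := by
  by_contra hne
  have hSc : (Sᶜ).Nonempty := by
    rwa [Finset.nonempty_iff_ne_empty, ne_eq, Finset.compl_eq_empty_iff]
  have h1 := sum_degree_lt_card_of_closed hG.isAcyclic hGP hS hGS
  have h2 := sum_degree_lt_card_of_closed hH.isAcyclic hHP hSc fun u v huv hu huS => by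
    rw [Finset.mem_compl] at huS ⊢
    exact fun hv => huS (hHS u v huv hu hv)
  have h3 := hG.sum_degree_bipartite hGP
  have h4 : ∑ i ∈ P with i ∈ Sᶜ, H.degree i = ∑ i ∈ P with i ∉ S, G.degree i := by
    simp only [Finset.mem_compl]
    exact Finset.sum_congr rfl fun i hi => (hdeg i (Finset.mem_filter.1 hi).1).symm
  have h5 := Finset.sum_filter_add_sum_filter_not P (· ∈ S) (fun i => G.degree i)
  have h6 := Finset.card_add_card_compl S
  omega

/-- A finite connected preorder in which not every pair is related admits a bipartite spanning tree,
all of whose edges are comparabilities from a set `P` of minimal elements to its complement. -/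
theorem exists_isTree_of_connected_preorder {V : Type*} [Finite V] [Nonempty V] (r : V → V → Prop)
    (hrefl : ∀ i, r i i) (htrans : ∀ i j k, r i j → r j k → r i k)
    (hconn : ∀ S : Set V, S.Nonempty → (∀ i j, r i j → (i ∈ S ↔ j ∈ S)) → S = Set.univ)
    (hne : ∃ i j, ¬ r i j) :
    ∃ (P : Set V) (G : SimpleGraph V), G.IsTree ∧
      (∀ u v, G.Adj u v → (u ∈ P ↔ v ∉ P)) ∧ ∀ u v, G.Adj u v → u ∈ P → r u v := by
  let P : Set V := {i | ∀ k, r k i → r i k}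
  let B : SimpleGraph V :=
    { Adj := fun u v => (u ∈ P ∧ v ∉ P ∧ r u v) ∨ (v ∈ P ∧ u ∉ P ∧ r v u)
      symm := ⟨fun u v h => h.symm⟩
      loopless := ⟨fun u h => by tauto⟩ }
  have hmin : ∀ v, ∃ i ∈ P, r i v := by
    intro v
    let : Preorder V := { le := r, le_refl := hrefl, le_trans := htrans }
    obtain ⟨b, hb, hbmin⟩ := exists_minimal_le_of_wellFoundedLT (fun _ : V => True) v trivial
    exact ⟨b, fun k hk => hbmin.2 trivial hk, hb⟩
  have hup : ∀ i ∈ P, ∃ x, x ∉ P ∧ r i x := by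
    intro i hi
    by_contra! hcon
    have hC : {x | r i x} = Set.univ := by
      refine hconn _ ⟨i, hrefl i⟩ fun x k hxk => ⟨fun h => htrans _ _ _ h hxk, fun h => ?_⟩
      have hk : k ∈ P := by_contra fun hk => hcon k hk h
      exact htrans _ _ _ h (hk x hxk)
    have hC' : ∀ x, r i x := fun x => by
      have : x ∈ {x | r i x} := hC ▸ Set.mem_univ x
      exact this
    obtain ⟨a, b, hab⟩ := hne
    have ha : a ∈ P := by_contra fun ha => hcon a ha (hC' a)
    exact hab (htrans _ _ _ (ha i (hC' a)) (hC' b))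
  have hreach : ∀ i ∈ P, ∀ u, r i u → B.Reachable i u := by
    intro i hi u hiu
    by_cases hu : u ∈ P
    · obtain ⟨x, hx, hix⟩ := hup i hi
      have h1 : B.Adj i x := Or.inl ⟨hi, hx, hix⟩
      have h2 : B.Adj x u := Or.inr ⟨hu, hx, htrans _ _ _ (hu i hiu) hix⟩
      exact h1.reachable.trans h2.reachable
    · have h1 : B.Adj i u := Or.inl ⟨hi, hu, hiu⟩
      exact h1.reachable
  have hreach' : ∀ u v, r u v → B.Reachable u v := by
    intro u v huv
    obtain ⟨i, hi, hiu⟩ := hmin u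
    exact (hreach i hi u hiu).symm.trans (hreach i hi v (htrans _ _ _ hiu huv))
  have hB : B.Connected := by
    refine ⟨fun u v => ?_⟩
    have h : {w | B.Reachable u w} = Set.univ := by
      refine hconn _ ⟨u, SimpleGraph.Reachable.rfl⟩ fun i j hij => ?_
      exact ⟨fun h => h.trans (hreach' i j hij), fun h => h.trans (hreach' i j hij).symm⟩
    have : v ∈ {w | B.Reachable u w} := h ▸ Set.mem_univ v
    exact this
  obtain ⟨T, hTB, hT⟩ := hB.exists_isTree_le
  refine ⟨P, T, hT, fun u v huv => ?_, fun u v huv hu => ?_⟩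
  · have := hTB huv
    simp only [B] at this
    tauto
  · have := hTB huv
    simp only [B] at this
    tauto

theorem mem_dualCone_solvencyCone {d : ℕ} {π : Fin d → Fin d → ℝ} {y : Fin d → ℝ} :
    y ∈ dualCone d (solvencyCone d π) ↔ ∀ i j, y j ≤ π i j * y i := by
  have key : ∀ z : Fin d → Fin d → ℝ,
      ∑ l, (∑ i, ∑ j, z i j • (π i j • (Pi.single i 1 : Fin d → ℝ) -
        (Pi.single j 1 : Fin d → ℝ))) l * y l = ∑ i, ∑ j, z i j * (π i j * y i - y j) := by
    intro z
    simp only [Finset.sum_apply, Finset.sum_mul]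
    rw [Finset.sum_comm]
    refine Finset.sum_congr rfl fun i _ => ?_
    rw [Finset.sum_comm]
    refine Finset.sum_congr rfl fun j _ => ?_
    simp only [Pi.smul_apply, Pi.sub_apply, smul_eq_mul, mul_assoc, ← Finset.mul_sum, sub_mul,
      Finset.sum_sub_distrib]
    simp [Pi.single_apply]
  constructor
  · intro hy i j
    have h := hy _ ⟨fun a b => if a = i ∧ b = j then 1 else 0,
      fun a b => by positivity, rfl⟩
    rw [key] at h
    simp only [ite_mul, one_mul, zero_mul, ite_and, Finset.sum_ite_irrel, Finset.sum_ite_eq',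
      Finset.sum_const_zero, Finset.mem_univ, if_true] at h
    linarith
  · rintro hy x ⟨z, hz, rfl⟩
    rw [key]
    exact Finset.sum_nonneg fun i _ => Finset.sum_nonneg fun j _ =>
      mul_nonneg (hz i j) (sub_nonneg.2 (hy i j))

theorem pos_of_forall_le_mul {V : Type*} {π : V → V → ℝ}
    (h2 : ∀ i j, 0 < π i j) (h3 : ∀ i j k, π i j ≤ π i k * π k j)
    (h4 : ∃ i j k, π i j < π i k * π k j) {y : V → ℝ}
    (hy : ∀ i j, y j ≤ π i j * y i) (hy0 : y ≠ 0) (i : V) : 0 < y i := by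
  obtain ⟨a, b, hab⟩ : ∃ a b, 1 < π a b * π b a := by
    by_contra! hcon
    obtain ⟨i, j, k, hijk⟩ := h4
    have hle : π i k * π k j ≤ π i j := by
      calc π i k * π k j ≤ π i k * (π k i * π i j) := by gcongr; exacts [(h2 _ _).le, h3 _ _ _]
        _ = (π i k * π k i) * π i j := by ring
        _ ≤ 1 * π i j := by gcongr; exacts [(h2 _ _).le, hcon _ _]
        _ = π i j := one_mul _
    exact hijk.not_ge hle
  have ha : 0 ≤ y a := by
    have h : y a ≤ π b a * (π a b * y a) :=
      (hy b a).trans (mul_le_mul_of_nonneg_left (hy a b) (h2 _ _).le)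
    nlinarith
  have hnonneg : ∀ l, 0 ≤ y l := fun l =>
    nonneg_of_mul_nonneg_right (ha.trans (hy l a)) (h2 l a)
  obtain ⟨c, hc⟩ := Function.ne_iff.1 hy0
  have hc : 0 < y c := lt_of_le_of_ne (hnonneg c) (Ne.symm hc)
  exact pos_of_mul_pos_right (hc.trans_le (hy i c)) (h2 i c).le

theorem IsExtremeDir.eq_univ_of_tight_closed {d : ℕ} {π : Fin d → Fin d → ℝ} {y : Fin d → ℝ}
    (hext : IsExtremeDir d (dualCone d (solvencyCone d π)) y) (hpos : ∀ i, 0 < y i)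
    {S : Set (Fin d)} (hS : S.Nonempty)
    (hcl : ∀ i j, y j = π i j * y i → (i ∈ S ↔ j ∈ S)) : S = Set.univ := by
  classical
  obtain ⟨hy, hy0, hdec⟩ := hext
  rw [mem_dualCone_solvencyCone] at hy
  by_contra hne
  obtain ⟨s, hs⟩ := hS
  obtain ⟨t, ht⟩ := (Set.ne_univ_iff_exists_notMem S).1 hne
  let w : ℝ → Fin d → ℝ := fun ε i => (1 / 2 + if i ∈ S then ε else 0) * y i
  have hev : ∀ᶠ ε in nhds (0 : ℝ), ∀ i j, w ε j ≤ π i j * w ε i := by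
    rw [Filter.eventually_all]
    intro i
    rw [Filter.eventually_all]
    intro j
    rcases (hy i j).lt_or_eq with hlt | heq
    · have h0 : w 0 j < π i j * w 0 i := by
        simp only [w, ite_self, add_zero]
        linarith
      have hcont : ∀ i, Continuous fun ε => w ε i := by
        intro i
        by_cases hi : i ∈ S <;> simp only [w, hi, if_true, if_false] <;> fun_prop
      filter_upwards [(hcont j).continuousAt.eventually_lt
        ((hcont i).const_mul (π i j)).continuousAt h0] with ε hε using hε.le
    · refine Filter.Eventually.of_forall fun ε => le_of_eq ?_
      simp only [w, hcl i j heq]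
      rw [heq]
      ring
  obtain ⟨δ, hδ, hball⟩ := Metric.eventually_nhds_iff.1 hev
  have hmem : ∀ ε, |ε| < δ → w ε ∈ dualCone d (solvencyCone d π) := fun ε hε =>
    mem_dualCone_solvencyCone.2 (hball (by simpa using hε))
  have hw0 : ∀ ε, w ε ≠ 0 := fun ε h => by
    have := congrFun h t
    simp [w, ht, (hpos t).ne'] at this
  have hwα : ∀ ε, ε ≠ 0 → ∀ α : ℝ, w ε ≠ α • y := fun ε hε α h => by
    have hs' := congrFun h s
    have ht' := congrFun h t
    simp only [w, hs, ht, if_true, if_false, Pi.smul_apply, smul_eq_mul] at hs' ht'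
    have h1 := mul_right_cancel₀ (hpos s).ne' hs'
    have h2 := mul_right_cancel₀ (hpos t).ne' ht'
    exact hε (by linarith)
  have hδ2 : δ / 2 ≠ 0 := by positivity
  have habs : |δ / 2| < δ := by rw [abs_of_pos (by positivity)]; linarith
  rcases hdec (w (δ / 2)) (w (-(δ / 2))) (hmem _ habs) (hmem _ (by rwa [abs_neg])) (hw0 _) (hw0 _)
    (by ext i; by_cases hi : i ∈ S <;> simp [w, hi] <;> ring) with ⟨α, -, h⟩ | ⟨α, -, h⟩
  · exact hwα _ hδ2 α h
  · exact hwα _ (neg_ne_zero.2 hδ2) α h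

/-- `y` is a positive solution of the system `y j ≤ π i j * y i` for which the inequalities along
the edges of some spanning tree between `P` and its complement are tight, where each `i ∈ P` has
degree `f i + 1` in the tree. -/
def IsTreeSolutionWithDegrees {V : Type*} [Fintype V] [DecidableEq V] (π : V → V → ℝ) (P : Finset V)
    (f : V → ℕ) (y : V → ℝ) : Prop :=
  (∀ i, 0 < y i) ∧ (∀ i j, y j ≤ π i j * y i) ∧
    ∃ (G : SimpleGraph V) (_ : DecidableRel G.Adj), G.IsTree ∧
      (∀ u v, G.Adj u v → (u ∈ P ↔ v ∉ P)) ∧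
      (∀ u v, G.Adj u v → u ∈ P → y v = π u v * y u) ∧ ∀ i ∈ P, G.degree i = f i + 1

theorem IsTreeSolutionWithDegrees.exists_eq_smul {V : Type*} [Fintype V] [DecidableEq V]
    [Nonempty V] {π : V → V → ℝ} {P : Finset V} {f : V → ℕ} {y z : V → ℝ}
    (hy : IsTreeSolutionWithDegrees π P f y) (hz : IsTreeSolutionWithDegrees π P f z) :
    ∃ α : ℝ, 0 < α ∧ y = α • z := by
  obtain ⟨hypos, hyle, G, _, hG, hGP, hGy, hGd⟩ := hy
  obtain ⟨hzpos, hzle, H, _, hH, hHP, hHz, hHd⟩ := hz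
  obtain ⟨m, hm⟩ := Finite.exists_max fun v => y v / z v
  set α := y m / z m
  have hα : 0 < α := div_pos (hypos m) (hzpos m)
  have hle : ∀ v, y v ≤ α * z v := fun v => (div_le_iff₀ (hzpos v)).1 (hm v)
  have hS : (Finset.univ.filter fun v => y v = α * z v) = Finset.univ := by
    refine eq_univ_of_closed_of_degree_eq hG hH hGP hHP
      (fun i hi => (hGd i hi).trans (hHd i hi).symm) ⟨m, ?_⟩ ?_ ?_
    · simp [α, div_mul_cancel₀ _ (hzpos m).ne']
    · intro u v huv hu huS
      simp only [Finset.mem_filter, Finset.mem_univ, true_and] at huS ⊢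
      refine (hle v).antisymm ?_
      calc α * z v ≤ α * (π u v * z u) := mul_le_mul_of_nonneg_left (hzle u v) hα.le
        _ = y v := by rw [hGy u v huv hu, huS]; ring
    · intro u v huv hu hvS
      simp only [Finset.mem_filter, Finset.mem_univ, true_and] at hvS ⊢
      refine (hle u).antisymm ?_
      have h := hyle u v
      rw [hvS, hHz u v huv hu] at h
      have hπ : 0 < π u v := by
        have := hzpos v
        rw [hHz u v huv hu] at this
        exact pos_of_mul_pos_left this (hzpos u).le
      refine le_of_mul_le_mul_left ?_ hπ
      linarith
  refine ⟨α, hα, funext fun v => ?_⟩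
  have : v ∈ Finset.univ.filter fun v => y v = α * z v := hS.ge (Finset.mem_univ v)
  simpa using this

theorem IsExtremeDir.exists_isTreeSolutionWithDegrees {d : ℕ} (hd : 2 ≤ d) {π : Fin d → Fin d → ℝ}
    (h1 : ∀ i, π i i = 1) (h2 : ∀ i j, 0 < π i j) (h3 : ∀ i j k, π i j ≤ π i k * π k j)
    (h4 : ∃ i j k, π i j < π i k * π k j) {y : Fin d → ℝ}
    (hext : IsExtremeDir d (dualCone d (solvencyCone d π)) y) :
    ∃ p ∈ Finset.Icc 1 (d - 1), ∃ P ∈ Finset.powersetCard p (Finset.univ : Finset (Fin d)),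
      ∃ f : Fin d →₀ ℕ, f ∈ Finset.finsuppAntidiag P (d - 1 - p) ∧
        IsTreeSolutionWithDegrees π P f y := by
  classical
  have hle := mem_dualCone_solvencyCone.1 hext.1
  have hpos := pos_of_forall_le_mul h2 h3 h4 hle hext.2.1
  have : Nonempty (Fin d) := ⟨⟨0, by omega⟩⟩
  have : Nontrivial (Fin d) := Fin.nontrivial_iff_two_le.2 hd
  obtain ⟨P, G, hG, hGP, hGy⟩ := exists_isTree_of_connected_preorder
    (fun i j => y j = π i j * y i) (fun i => by rw [h1, one_mul])
    (fun i j k hij hjk => (hle i k).antisymm <| by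
      rw [hjk, hij, ← mul_assoc, mul_comm (π j k)]
      exact mul_le_mul_of_nonneg_right (h3 i k j) (hpos i).le)
    (fun S hS hcl => hext.eq_univ_of_tight_closed hpos hS hcl)
    (by
      by_contra! hall
      obtain ⟨i, j, k, hijk⟩ := h4
      have h := mul_lt_mul_of_pos_right hijk (hpos i)
      have := hall i j
      have := hall k j
      rw [hall i k] at this
      nlinarith)
  have hGP' : ∀ u v, G.Adj u v → (u ∈ P.toFinset ↔ v ∉ P.toFinset) := by simpa using hGP
  have hsum := hG.sum_degree_bipartite hGP'
  have hdeg : ∀ i, 1 ≤ G.degree i := fun i => hG.connected.preconnected.degree_pos_of_nontrivial i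
  have hsub : ∑ i ∈ P.toFinset, (G.degree i - 1) + P.toFinset.card =
      ∑ i ∈ P.toFinset, G.degree i := by
    rw [Finset.card_eq_sum_ones, ← Finset.sum_add_distrib]
    exact Finset.sum_congr rfl fun i _ => Nat.sub_add_cancel (hdeg i)
  have hne : P.toFinset.Nonempty := by
    rw [Finset.nonempty_iff_ne_empty]
    intro h
    rw [h] at hsum
    simp at hsum
    omega
  rw [Fintype.card_fin] at hsum
  refine ⟨P.toFinset.card, Finset.mem_Icc.2 ⟨hne.card_pos, by omega⟩, P.toFinset,
    Finset.mem_powersetCard.2 ⟨Finset.subset_univ _, rfl⟩,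
    Finsupp.onFinset P.toFinset (fun i => if i ∈ P.toFinset then G.degree i - 1 else 0)
      (fun i hi => by by_contra h; simp [h] at hi), ?_, hpos, hle, G, inferInstance, hG, hGP',
      fun u v huv hu => hGy u v huv (by simpa using hu), fun i hi => ?_⟩
  · rw [Finset.mem_finsuppAntidiag]
    refine ⟨?_, Finsupp.support_onFinset_subset⟩
    have : ∑ i ∈ P.toFinset, (if i ∈ P.toFinset then G.degree i - 1 else 0) =
        ∑ i ∈ P.toFinset, (G.degree i - 1) := Finset.sum_congr rfl fun i hi => if_pos hi
    change ∑ i ∈ P.toFinset, (if i ∈ P.toFinset then G.degree i - 1 else 0) = _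
    omega
  · rw [Finsupp.onFinset_apply, if_pos hi, Nat.sub_add_cancel (hdeg i)]

/-- Corollary 10: `K_d^+` has at most `∑_{p=1}^{d-1} C(d-2,p-1) · C(d,p)` extreme
directions (up to positive scaling): there is a finite set `Y` of at most that many
vectors such that every extreme direction of `K_d^+` is a positive multiple of a
member of `Y`. -/
theorem atMost_extremeDirs (d : ℕ) (hd : 2 ≤ d) (π : Fin d → Fin d → ℝ)
    (h1 : ∀ i, π i i = 1)
    (h2 : ∀ i j, 0 < π i j)
    (h3 : ∀ i j k, π i j ≤ π i k * π k j)
    (h4 : ∃ i j k, π i j < π i k * π k j) :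
    ∃ Y : Finset (Fin d → ℝ),
      Y.card ≤ ∑ p ∈ Finset.Icc 1 (d - 1), (d - 2).choose (p - 1) * d.choose p ∧
      ∀ y : Fin d → ℝ, IsExtremeDir d (dualCone d (solvencyCone d π)) y →
        ∃ z ∈ Y, ∃ α : ℝ, 0 < α ∧ y = α • z := by
  classical
  have : Nonempty (Fin d) := ⟨⟨0, by omega⟩⟩
  let F : Finset (Fin d) → (Fin d →₀ ℕ) → Fin d → ℝ := fun P f =>
    if h : ∃ y, IsTreeSolutionWithDegrees π P f y then h.choose else 0
  have hF : ∀ (P : Finset (Fin d)) (f : Fin d →₀ ℕ) (y : Fin d → ℝ),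
      IsTreeSolutionWithDegrees π P f y → IsTreeSolutionWithDegrees π P f (F P f) := by
    intro P f y hy
    have h : ∃ y, IsTreeSolutionWithDegrees π P f y := ⟨y, hy⟩
    simpa only [F, dif_pos h] using h.choose_spec
  refine ⟨(Finset.Icc 1 (d - 1)).biUnion fun p =>
    (Finset.powersetCard p (Finset.univ : Finset (Fin d))).biUnion fun P =>
      (Finset.finsuppAntidiag P (d - 1 - p)).image (F P), ?_, fun y hy => ?_⟩
  · refine Finset.card_biUnion_le.trans (Finset.sum_le_sum fun p hp => ?_)
    rw [Finset.mem_Icc] at hp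
    refine (Finset.card_biUnion_le_card_mul _ _ ((d - 2).choose (p - 1)) fun P hP => ?_).trans ?_
    · refine Finset.card_image_le.trans ?_
      rw [Finset.card_finsuppAntidiag_nat_eq_choose, (Finset.mem_powersetCard.1 hP).2,
        show p + (d - 1 - p) - 1 = d - 2 by omega, show d - 1 - p = d - 2 - (p - 1) by omega,
        Nat.choose_symm (by omega)]
    · rw [Finset.card_powersetCard, Finset.card_univ, Fintype.card_fin, mul_comm]
  · obtain ⟨p, hp, P, hP, f, hf, hy⟩ := hy.exists_isTreeSolutionWithDegrees hd h1 h2 h3 h4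
    refine ⟨F P f, ?_, hy.exists_eq_smul (hF P f y hy)⟩
    simp only [Finset.mem_biUnion, Finset.mem_image]
    exact ⟨p, hp, P, hP, f, hf, rfl⟩
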